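/- Let H_1, …, H_n be non-solvable groups, and let π : H_1 × ⋯ × H_n → H be a surjective group homomorphism whose restriction to each factor H_i is injective. If ρ : H → GL_d(ℂ) is a faithful linear representation, then d ≥ 2n. -/

import Mathlib

namespace Representation

open Module

variable {k G V : Type*} [Field k] [Group G] [AddCommGroup V] [Module k V]

/-- The image of the representation `ρ` is not solvable: no term of the derived series of `G`
acts trivially. -/
def HasNonsolvableImage (ρ : Representation k G V) : Prop :=
  ∀ m, ∃ g ∈ derivedSeries G m, ρ g ≠ 1

theorem hasNonsolvableImage_of_injective {ρ : Representation k G V}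
    (hρ : Function.Injective ρ) (hG : ¬ Group.IsSolvable G) : ρ.HasNonsolvableImage := by
  intro m
  by_contra! h
  refine hG ⟨m, (Subgroup.eq_bot_iff_forall _).2 fun g hg => hρ ?_⟩
  rw [h g hg, map_one]

/-- If the elements of the `m`-th derived subgroup have commuting images, then the image of the
representation is solvable. -/
theorem HasNonsolvableImage.exists_not_commute {ρ : Representation k G V}
    (hρ : ρ.HasNonsolvableImage) (m : ℕ) :
    ∃ g ∈ derivedSeries G m, ∃ h ∈ derivedSeries G m, ¬ Commute (ρ g) (ρ h) := by
  by_contra! hcomm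
  obtain ⟨g, hg, hne⟩ := hρ (m + 1)
  refine hne ?_
  have hle : derivedSeries G (m + 1) ≤ MonoidHom.ker ρ := by
    rw [derivedSeries_succ, Subgroup.commutator_le]
    intro a ha b hb
    rw [MonoidHom.mem_ker, commutatorElement_def, map_mul, map_mul, map_mul,
      (hcomm a ha b hb).eq, mul_assoc (ρ b), ← map_mul ρ a, mul_inv_cancel, map_one, mul_one,
      ← map_mul, mul_inv_cancel, map_one]
  exact hle hg

theorem HasNonsolvableImage.exists_ne_smul_one {ρ : Representation k G V}
    (hρ : ρ.HasNonsolvableImage) : ∃ g, ∀ c : k, ρ g ≠ c • 1 := by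
  by_contra! h
  obtain ⟨a, -, b, -, hab⟩ := hρ.exists_not_commute 0
  obtain ⟨c, hc⟩ := h a
  exact hab (hc ▸ (Commute.one_left _).smul_left c)

/-- A representation with non-solvable image has non-solvable image on any invariant subspace or
on the corresponding quotient. -/
theorem HasNonsolvableImage.subrepresentation_or_quotient {ρ : Representation k G V}
    (hρ : ρ.HasNonsolvableImage) (W : Submodule k V) (hW : ∀ g, W ≤ W.comap (ρ g)) :
    (ρ.subrepresentation W hW).HasNonsolvableImage ∨ (ρ.quotient W hW).HasNonsolvableImage := by
  by_contra! h
  simp only [HasNonsolvableImage, not_forall, not_exists, not_and, not_not] at h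
  obtain ⟨⟨a, ha⟩, b, hb⟩ := h
  have hsub : ∀ g ∈ derivedSeries G (max a b), ∀ w ∈ W, ρ g w = w := by
    intro g hg w hw
    have := LinearMap.congr_fun (ha g (derivedSeries_antitone G (le_max_left a b) hg)) ⟨w, hw⟩
    exact congrArg Subtype.val this
  have hquot : ∀ g ∈ derivedSeries G (max a b), ∀ v, ρ g v - v ∈ W := by
    intro g hg v
    have := LinearMap.congr_fun (hb g (derivedSeries_antitone G (le_max_right a b) hg))
      (Submodule.Quotient.mk v)
    exact (Submodule.Quotient.eq W).1 this
  obtain ⟨g, hg, h, hh, hgh⟩ := hρ.exists_not_commute (max a b)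
  refine hgh (LinearMap.ext fun v => ?_)
  have h₁ := hsub g hg _ (hquot h hh v)
  have h₂ := hsub h hh _ (hquot g hg v)
  rw [map_sub, sub_eq_sub_iff_add_eq_add] at h₁ h₂
  rw [Module.End.mul_apply, Module.End.mul_apply]
  have h₃ : ρ g (ρ h v) = ρ h v - v + ρ g v := by rw [← sub_eq_iff_eq_add.2 h₁.symm]; abel
  have h₄ : ρ h (ρ g v) = ρ g v - v + ρ h v := by rw [← sub_eq_iff_eq_add.2 h₂.symm]; abel
  rw [h₃, h₄]
  abel

section Commuting

variable {ι : Type*} {H : ι → Type*} [∀ i, Group (H i)] {ρ : ∀ i, Representation k (H i) V}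

/-- For commuting actions without common invariant subspaces, non-solvability of the image of one
of them is inherited by each of its nonzero invariant subspaces. -/
theorem HasNonsolvableImage.subrepresentation_of_irreducible
    (hcomm : ∀ i j, i ≠ j → ∀ g h, Commute (ρ i g) (ρ j h))
    (hirr : ∀ W : Submodule k V, (∀ i g, W ≤ W.comap (ρ i g)) → W = ⊥ ∨ W = ⊤)
    {j : ι} (hρ : (ρ j).HasNonsolvableImage) {W : Submodule k V} (hne : W ≠ ⊥)
    (hW : ∀ g, W ≤ W.comap (ρ j g)) :
    ((ρ j).subrepresentation W hW).HasNonsolvableImage := by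
  intro m
  by_contra! h
  let F : Submodule k V := ⨅ x : derivedSeries (H j) m, LinearMap.eqLocus (ρ j x) LinearMap.id
  have hF : ∀ v, v ∈ F ↔ ∀ x ∈ derivedSeries (H j) m, ρ j x v = v := by
    intro v
    simp [F, Submodule.mem_iInf, LinearMap.mem_eqLocus]
  have hWF : W ≤ F := fun w hw => (hF w).2 fun x hx =>
    congrArg Subtype.val (LinearMap.congr_fun (h x hx) ⟨w, hw⟩)
  have hinv : ∀ i g, F ≤ F.comap (ρ i g) := by
    intro i g v hv
    rw [Submodule.mem_comap, hF]
    rw [hF] at hv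
    intro x hx
    by_cases hij : i = j
    · subst hij
      have hconj := hv _ ((derivedSeries_normal (H i) m).conj_mem x hx g⁻¹)
      calc ρ i x (ρ i g v) = ρ i g (ρ i (g⁻¹ * x * g⁻¹⁻¹) v) := by
            simp only [← Module.End.mul_apply, ← map_mul]
            congr 2
            group
        _ = ρ i g v := by rw [hconj]
    · have hc := LinearMap.congr_fun (hcomm i j hij g x).eq v
      rw [Module.End.mul_apply, Module.End.mul_apply, hv x hx] at hc
      exact hc.symm
  obtain hbot | htop := hirr F hinv
  · exact hne (le_bot_iff.1 (hbot ▸ hWF))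
  · obtain ⟨g, hg, hg1⟩ := hρ m
    exact hg1 (LinearMap.ext fun v => (hF v).1 (htop ▸ Submodule.mem_top) g hg)

end Commuting

/-- Commuting representations with non-solvable images on a finite-dimensional space `V` over an
algebraically closed field number at most half the dimension of `V`. -/
theorem two_mul_card_le_finrank_of_hasNonsolvableImage {k : Type*} [Field k] [IsAlgClosed k]
    {V : Type*} [AddCommGroup V] [Module k V] [FiniteDimensional k V]
    {ι : Type*} [Fintype ι] {H : ι → Type*} [∀ i, Group (H i)]
    (ρ : ∀ i, Representation k (H i) V)
    (hcomm : ∀ i j, i ≠ j → ∀ g h, Commute (ρ i g) (ρ j h))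
    (hρ : ∀ i, (ρ i).HasNonsolvableImage) :
    2 * Fintype.card ι ≤ finrank k V := by
  classical
  induction hd : finrank k V using Nat.strong_induction_on generalizing V ι with
  | _ d ih =>
  subst hd
  by_cases hirr : ∀ W : Submodule k V, (∀ i g, W ≤ W.comap (ρ i g)) → W = ⊥ ∨ W = ⊤
  · obtain hι | ⟨⟨i⟩⟩ := isEmpty_or_nonempty ι
    · simp
    obtain ⟨h, hh⟩ := (hρ i).exists_ne_smul_one
    have : Nontrivial V := by
      by_contra hV
      rw [not_nontrivial_iff_subsingleton] at hV
      exact hh 1 (Subsingleton.elim _ _)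
    obtain ⟨c, hc⟩ := Module.End.exists_eigenvalue (ρ i h)
    set T : Module.End k V := ρ i h - c • 1 with hT
    have hTcomm : ∀ j ≠ i, ∀ g, Commute (ρ j g) T := fun j hj g =>
      (hcomm j i hj g h).sub_right ((Commute.one_right _).smul_right c)
    have hker : LinearMap.ker T ≠ ⊥ := by
      obtain ⟨v, hv⟩ := hc.exists_hasEigenvector
      refine (Submodule.ne_bot_iff _).2 ⟨v, ?_, hv.2⟩
      simp [hT, hv.apply_eq_smul]
    have hrange : LinearMap.range T ≠ ⊥ := fun h0 =>
      hh c (sub_eq_zero.1 (LinearMap.range_eq_bot.1 h0))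
    have hsum := LinearMap.finrank_range_add_finrank_ker T
    have hker_pos := Submodule.one_le_finrank_iff.2 hker
    have hrange_pos := Submodule.one_le_finrank_iff.2 hrange
    have hbound : ∀ W : Submodule k V, W ≠ ⊥ → finrank k W < finrank k V →
        (∀ j ≠ i, ∀ g, W ≤ W.comap (ρ j g)) →
        2 * Fintype.card {j // j ≠ i} ≤ finrank k W := by
      intro W hne hlt hW
      refine ih _ hlt (fun j : {j // j ≠ i} => (ρ j).subrepresentation W (hW j j.2)) ?_ ?_ rfl
      · intro a b hab g g'
        ext w
        exact LinearMap.congr_fun (hcomm a b (Subtype.coe_ne_coe.2 hab) g g').eq w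
      · exact fun j => (hρ j).subrepresentation_of_irreducible hcomm hirr hne (hW j j.2)
    have h₁ := hbound (LinearMap.ker T) hker (by lia) fun j hj g v hv => by
      have := LinearMap.congr_fun (hTcomm j hj g).eq v
      simp only [Module.End.mul_apply] at this
      rw [Submodule.mem_comap, LinearMap.mem_ker, ← this, LinearMap.mem_ker.1 hv, map_zero]
    have h₂ := hbound (LinearMap.range T) hrange (by lia) fun j hj g v hv => by
      obtain ⟨w, rfl⟩ := hv
      exact ⟨ρ j g w, (LinearMap.congr_fun (hTcomm j hj g).eq w).symm⟩
    have hcard : Fintype.card {j // j ≠ i} = Fintype.card ι - 1 := by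
      simp [Fintype.card_subtype_compl]
    lia
  · push Not at hirr
    obtain ⟨W, hW, hbot, htop⟩ := hirr
    have hsum := W.finrank_quotient_add_finrank
    have hpos := Submodule.one_le_finrank_iff.2 hbot
    have hlt := Submodule.finrank_lt htop
    let p : ι → Prop := fun i => ((ρ i).subrepresentation W (hW i)).HasNonsolvableImage
    have h₁ : 2 * Fintype.card {i // p i} ≤ finrank k W := by
      refine ih _ hlt (fun i : {i // p i} => (ρ i).subrepresentation W (hW i)) ?_
        (fun i => i.2) rfl
      intro a b hab g g'
      ext w
      exact LinearMap.congr_fun (hcomm a b (Subtype.coe_ne_coe.2 hab) g g').eq w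
    have h₂ : 2 * Fintype.card {i // ¬ p i} ≤ finrank k (V ⧸ W) := by
      refine ih _ (by lia) (fun i : {i // ¬ p i} => (ρ i).quotient W (hW i)) ?_
        (fun i => ((hρ i).subrepresentation_or_quotient W (hW i)).resolve_left i.2) rfl
      intro a b hab g g'
      ext v
      exact congrArg (Submodule.Quotient.mk (p := W))
        (LinearMap.congr_fun (hcomm a b (Subtype.coe_ne_coe.2 hab) g g').eq v)
    have hcard : Fintype.card {i // p i} + Fintype.card {i // ¬ p i} = Fintype.card ι := by
      rw [← Fintype.card_sum]
      exact Fintype.card_congr (Equiv.sumCompl p)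
    lia

end Representation

theorem stmt_5 (n d : ℕ) (H : Fin n → Type) [∀ i, Group (H i)]
    (hH : ∀ i, ¬ IsSolvable (H i))
    (G : Type) [Group G]
    (π : ((i : Fin n) → H i) →* G)
    (hsurj : Function.Surjective π)
    (hinj : ∀ i, Function.Injective (π.comp (MonoidHom.mulSingle H i)))
    (ρ : G →* Matrix.GeneralLinearGroup (Fin d) ℂ)
    (hρ : Function.Injective ρ) :
    2 * n ≤ d := by
  let τ : G →* Module.End ℂ (Fin d → ℂ) :=
    (Matrix.toLinAlgEquiv' : Matrix (Fin d) (Fin d) ℂ ≃ₐ[ℂ] _).toMonoidHom.comp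
      ((Units.coeHom _).comp ρ)
  have hτ : Function.Injective τ :=
    Matrix.toLinAlgEquiv'.injective.comp (Units.val_injective.comp hρ)
  let σ : ∀ i, Representation ℂ (H i) (Fin d → ℂ) :=
    fun i => τ.comp (π.comp (MonoidHom.mulSingle H i))
  have h := Representation.two_mul_card_le_finrank_of_hasNonsolvableImage σ
    (fun i j hij g g' => ((Pi.mulSingle_commute hij g g').map π).map τ)
    (fun i => Representation.hasNonsolvableImage_of_injective (hτ.comp (hinj i)) (hH i))
  simpa using h
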